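/- Let X be an involutory knot-theoretic ternary quasigroup (IKTQ), n ≥ 1, x = (x_0, ..., x_{n+1}) an (n+2)-tuple of elements of X, and 1 ≤ j ≤ n. Then: (i) d_j^{n,L}(x[j]) = d_{j-1}^{n,L}(x); and (ii) for every i with j+1 ≤ i ≤ n, d_i^{n,L}(x[j]) = (d_{i,1}^{n,L}x, ..., d_{i,j}^{n,L}x, (d_{i,j}^{n,L}x)(d_{i,j+1}^{n,L}x)(d_{i,j+2}^{n,L}x)T, d_{i,j+2}^{n,L}x, ..., d_{i,n+1}^{n,L}x), that is, d_i^{n,L}(x[j]) is obtained from d_i^{n,L}x by replacing its (j+1)-st coordinate with (d_{i,j}^{n,L}x)(d_{i,j+1}^{n,L}x)(d_{i,j+2}^{n,L}x)T. -/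

import Mathlib

variable {X : Type*}

/-- The reversed operation `T̂`, with `xyzT̂ = zyxT`. -/
def hatOp (S : X → X → X → X) : X → X → X → X := fun x y z => S z y x

/-- Extend an `(n+2)`-tuple `x = (x_0, …, x_{n+1})` to a function on `ℕ`
(values beyond index `n+1` are irrelevant junk). -/
def ext (n : ℕ) (x : Fin (n + 2) → X) : ℕ → X :=
  fun m => if h : m < n + 2 then x ⟨m, h⟩ else x 0

/-- Coordinate description of the left face maps: `d_{i,k}^{L}` is `x_k` for
`k > i` and `x_{k-1}x_k(d_{i,k+1}^{L}x)T` for `k ≤ i` (computed right to left). -/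
def dLcoord (T : X → X → X → X) (i : ℕ) (x : ℕ → X) (k : ℕ) : X :=
  if h : i < k then x k
  else T (x (k - 1)) (x k) (dLcoord T i x (k + 1))
termination_by i + 1 - k
decreasing_by omega

/-- Coordinate description of the right face maps: `d_{i,k}^{R}` is `x_k` for
`k ≤ i` and `(d_{i,k-1}^{R}x)x_kx_{k+1}T` for `k > i` (computed left to right). -/
def dRcoord (T : X → X → X → X) (i : ℕ) (x : ℕ → X) (k : ℕ) : X :=
  if h : k ≤ i then x k
  else T (dRcoord T i x (k - 1)) (x k) (x (k + 1))
termination_by k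
decreasing_by omega

/-- Inductive description of the left face maps:
`d_0^{L}x = (x_1, …, x_{n+1})` and
`d_i^{L}x = d_{i-1}^{L}(x  with  x_i ↦ x_{i-1}x_ix_{i+1}T)`.
The result is indexed so that entry `k` is the `(k+1)`-st coordinate. -/
def dLind (T : X → X → X → X) : ℕ → (ℕ → X) → ℕ → X
  | 0, x, k => x (k + 1)
  | i + 1, x, k =>
      dLind T i (fun m => if m = i + 1 then T (x i) (x (i + 1)) (x (i + 2)) else x m) k

/-- The left face map `d_i^{n,L}` (coordinate description), as a map from
`(n+2)`-tuples to `(n+1)`-tuples; entry `p` is the coordinate `d_{i,p+1}^{n,L}`. -/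
def dL (T : X → X → X → X) (n i : ℕ) (x : Fin (n + 2) → X) : Fin (n + 1) → X :=
  fun p => dLcoord T i (ext n x) (p.1 + 1)

/-- The left face map `d_i^{n,L}` (inductive description). -/
def dLInd (T : X → X → X → X) (n i : ℕ) (x : Fin (n + 2) → X) : Fin (n + 1) → X :=
  fun p => dLind T i (ext n x) p.1

/-- The right face map `d_i^{n,R}`; entry `p` is the coordinate `d_{i,p}^{n,R}`. -/
def dR (T : X → X → X → X) (n i : ℕ) (x : Fin (n + 2) → X) : Fin (n + 1) → X :=
  fun p => dRcoord T i (ext n x) p.1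

/-- The boundary homomorphism `∂_{n}^{L} = Σ_{i=0}^{n} (-1)^i d_i^{n,L}`
on the free abelian group on `(n+2)`-tuples (used for `n ≥ 1`). -/
def boundaryL (T : X → X → X → X) (n : ℕ) :
    FreeAbelianGroup (Fin (n + 2) → X) →+ FreeAbelianGroup (Fin (n + 1) → X) :=
  FreeAbelianGroup.lift fun x =>
    ∑ i ∈ Finset.range (n + 1), ((-1 : ℤ) ^ i) • FreeAbelianGroup.of (dL T n i x)

/-- The boundary homomorphism `∂_{n}^{R} = Σ_{i=0}^{n} (-1)^i d_i^{n,R}`. -/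
def boundaryR (T : X → X → X → X) (n : ℕ) :
    FreeAbelianGroup (Fin (n + 2) → X) →+ FreeAbelianGroup (Fin (n + 1) → X) :=
  FreeAbelianGroup.lift fun x =>
    ∑ i ∈ Finset.range (n + 1), ((-1 : ℤ) ^ i) • FreeAbelianGroup.of (dR T n i x)

/-- The boundary homomorphism `∂_n = ∂_n^L - ∂_n^R`. -/
def boundary (T : X → X → X → X) (n : ℕ) :
    FreeAbelianGroup (Fin (n + 2) → X) →+ FreeAbelianGroup (Fin (n + 1) → X) :=
  boundaryL T n - boundaryR T n

/-- An `(m+2)`-tuple is degenerate if it contains, on three consecutive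
coordinates, a triple `(a, b, abbR)` (condition D1) or `(bbaL, b, a)`
(condition D2). -/
def IsDegenerate (L R : X → X → X → X) (m : ℕ) (x : Fin (m + 2) → X) : Prop :=
  ∃ (j : ℕ) (h : j + 2 < m + 2) (a b : X),
    (x ⟨j, by omega⟩ = a ∧ x ⟨j + 1, by omega⟩ = b ∧ x ⟨j + 2, h⟩ = R a b b) ∨
    (x ⟨j, by omega⟩ = L b b a ∧ x ⟨j + 1, by omega⟩ = b ∧ x ⟨j + 2, h⟩ = a)

/-- `C_m^D(X)`: the subgroup of `C_m(X)` generated by the degenerate tuples. -/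
def CD (L R : X → X → X → X) (m : ℕ) :
    AddSubgroup (FreeAbelianGroup (Fin (m + 2) → X)) :=
  AddSubgroup.closure {c | ∃ x, IsDegenerate L R m x ∧ c = FreeAbelianGroup.of x}

/-- `x[j]`: the tuple obtained from `x` by replacing `x_j` with `x_{j-1}x_jx_{j+1}T`. -/
def tupleSub (T : X → X → X → X) (m : ℕ) (x : Fin (m + 2) → X) (j : ℕ)
    (h1 : 1 ≤ j) (h2 : j ≤ m) : Fin (m + 2) → X :=
  Function.update x ⟨j, by omega⟩
    (T (x ⟨j - 1, by omega⟩) (x ⟨j, by omega⟩) (x ⟨j + 1, by omega⟩))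

/-- `C_m^I(X)`: the subgroup of `C_m(X)` generated by the sums `x + x[j]`,
`1 ≤ j ≤ m`. -/
def CI (T : X → X → X → X) (m : ℕ) :
    AddSubgroup (FreeAbelianGroup (Fin (m + 2) → X)) :=
  AddSubgroup.closure {c | ∃ (x : Fin (m + 2) → X) (j : ℕ) (h1 : 1 ≤ j) (h2 : j ≤ m),
    c = FreeAbelianGroup.of x + FreeAbelianGroup.of (tupleSub T m x j h1 h2)}

/-- `C_m^{ID}(X)`: the subgroup of `C_m(X)` generated by the sums `x + x[j]`
together with the degenerate tuples. -/
def CID (T L R : X → X → X → X) (m : ℕ) :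
    AddSubgroup (FreeAbelianGroup (Fin (m + 2) → X)) :=
  AddSubgroup.closure
    ({c | ∃ (x : Fin (m + 2) → X) (j : ℕ) (h1 : 1 ≤ j) (h2 : j ≤ m),
        c = FreeAbelianGroup.of x + FreeAbelianGroup.of (tupleSub T m x j h1 h2)} ∪
      {c | ∃ x, IsDegenerate L R m x ∧ c = FreeAbelianGroup.of x})

/-- Reversal of a tuple. -/
def revTuple {m : ℕ} (x : Fin m → X) : Fin m → X := fun k => x k.rev

theorem dLcoord_of_lt (T : X → X → X → X) {i k : ℕ} (x : ℕ → X) (h : i < k) :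
    dLcoord T i x k = x k := by
  rw [dLcoord, dif_pos h]

theorem dLcoord_of_le (T : X → X → X → X) {i k : ℕ} (x : ℕ → X) (h : k ≤ i) :
    dLcoord T i x k = T (x (k - 1)) (x k) (dLcoord T i x (k + 1)) := by
  rw [dLcoord, dif_neg (by omega)]

/-- The coordinate `d_{i,k}` depends only on the entries with index at least `k - 1`. -/
theorem dLcoord_congr (T : X → X → X → X) {i k : ℕ} {x y : ℕ → X}
    (hxy : ∀ m, k - 1 ≤ m → x m = y m) : dLcoord T i x k = dLcoord T i y k := by
  by_cases h : i < k
  · rw [dLcoord_of_lt T x h, dLcoord_of_lt T y h, hxy k (by omega)]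
  · rw [dLcoord_of_le T x (by omega), dLcoord_of_le T y (by omega), hxy (k - 1) le_rfl,
      hxy k (by omega), dLcoord_congr T (k := k + 1) fun m hm => hxy m (by omega)]
termination_by i + 1 - k

/-- If two tuples agree before index `K` and their face maps agree at coordinate `K`, then the
face maps agree at all earlier coordinates. -/
theorem dLcoord_eq_of_le (T : X → X → X → X) {i i' k K : ℕ} {x y : ℕ → X}
    (hi : K ≤ i + 1) (hi' : K ≤ i' + 1) (hxy : ∀ m < K, x m = y m)
    (hK : dLcoord T i x K = dLcoord T i' y K) (hk : 1 ≤ k) (hkK : k ≤ K) :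
    dLcoord T i x k = dLcoord T i' y k := by
  induction hkK using Nat.decreasingInduction with
  | self => exact hK
  | of_succ k hlt ih =>
    rw [dLcoord_of_le T x (by omega), dLcoord_of_le T y (by omega), hxy _ hlt,
      hxy (k - 1) (by omega), ih (by omega)]

/-- The substitution `x ↦ x[j]` on infinite sequences. -/
def seqSub (T : X → X → X → X) (x : ℕ → X) (j : ℕ) : ℕ → X :=
  Function.update x j (T (x (j - 1)) (x j) (x (j + 1)))

theorem seqSub_of_ne (T : X → X → X → X) (x : ℕ → X) {j m : ℕ} (h : m ≠ j) :
    seqSub T x j m = x m :=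
  Function.update_of_ne h _ _

theorem seqSub_self (T : X → X → X → X) (x : ℕ → X) (j : ℕ) :
    seqSub T x j j = T (x (j - 1)) (x j) (x (j + 1)) :=
  Function.update_self _ _ _

theorem ext_tupleSub (T : X → X → X → X) (n : ℕ) (x : Fin (n + 2) → X) (j : ℕ)
    (h1 : 1 ≤ j) (h2 : j ≤ n) :
    ext n (tupleSub T n x j h1 h2) = seqSub T (ext n x) j := by
  funext m
  by_cases hm : m = j
  · subst hm
    rw [seqSub_self]
    simp [ext, tupleSub, show m < n + 2 by omega, show m - 1 < n + 2 by omega,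
      show m + 1 < n + 2 by omega]
  · rw [seqSub_of_ne T _ hm]
    have h0 : (0 : Fin (n + 2)) ≠ ⟨j, by omega⟩ := by
      simp only [ne_eq, Fin.ext_iff, Fin.val_zero]
      omega
    simp [ext, tupleSub, hm, h0]

theorem dLcoord_seqSub_self (T : X → X → X → X)
    (hinv : ∀ a b c : X, T a (T a b c) c = b) (x : ℕ → X) {j k : ℕ} (hj : 1 ≤ j) (hk : 1 ≤ k) :
    dLcoord T j (seqSub T x j) k = dLcoord T (j - 1) x k := by
  rcases lt_or_ge j k with h | h
  · rw [dLcoord_of_lt T _ h, dLcoord_of_lt T _ (by omega), seqSub_of_ne T x (by omega)]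
  · refine dLcoord_eq_of_le T (K := j) (by omega) (by omega)
      (fun m hm => seqSub_of_ne T x hm.ne) ?_ hk h
    rw [dLcoord_of_le T _ le_rfl, dLcoord_of_lt T _ (Nat.lt_succ_self j),
      dLcoord_of_lt T x (by omega), seqSub_self, seqSub_of_ne T x (by omega),
      seqSub_of_ne T x (by omega), hinv]

theorem dLcoord_seqSub_succ (T : X → X → X → X)
    (hA3L : ∀ a b c d : X, T (T a b c) c d = T (T a b (T b c d)) (T b c d) d)
    (x : ℕ → X) {i j : ℕ} (hi : j + 1 ≤ i) :
    dLcoord T i (seqSub T x j) (j + 1) =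
      T (dLcoord T i x j) (dLcoord T i x (j + 1)) (dLcoord T i x (j + 2)) := by
  rw [dLcoord_of_le T x (show j ≤ i by omega), dLcoord_of_le T x hi, dLcoord_of_le T _ hi,
    dLcoord_congr T (k := j + 1 + 1) (y := x) fun m hm => seqSub_of_ne T x (by omega),
    Nat.add_sub_cancel, seqSub_self, seqSub_of_ne T x (by omega), hA3L]

theorem dLcoord_seqSub_of_ne (T : X → X → X → X)
    (hA3R : ∀ a b c d : X, T a b (T b c d) = T a (T a b c) (T (T a b c) c d))
    (x : ℕ → X) {i j k : ℕ} (hj : 1 ≤ j) (hi : j + 1 ≤ i) (hk : 1 ≤ k) (hkj : k ≠ j + 1) :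
    dLcoord T i (seqSub T x j) k = dLcoord T i x k := by
  rcases lt_or_ge j k with h | h
  · exact dLcoord_congr T fun m hm => seqSub_of_ne T x (by omega)
  · refine dLcoord_eq_of_le T (K := j) (by omega) (by omega)
      (fun m hm => seqSub_of_ne T x hm.ne) ?_ hk h
    rw [dLcoord_of_le T x (show j ≤ i by omega), dLcoord_of_le T x hi,
      dLcoord_of_le T _ (show j ≤ i by omega), dLcoord_of_le T _ hi,
      dLcoord_congr T (k := j + 1 + 1) (y := x) fun m hm => seqSub_of_ne T x (by omega),
      Nat.add_sub_cancel, seqSub_self, seqSub_of_ne T x (m := j + 1) (by omega),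
      seqSub_of_ne T x (m := j - 1) (by omega), ← hA3R]

/-- for an IKTQ `X` (a ternary quasigroup `(X,T,L,T,R)`, i.e.
with `T = M`, satisfying A3L and A3R), `n ≥ 1`, an `(n+2)`-tuple `x`, and
`1 ≤ j ≤ n`:
(i) `d_j^{n,L}(x[j]) = d_{j-1}^{n,L}(x)`; and
(ii) for every `i` with `j+1 ≤ i ≤ n`, `d_i^{n,L}(x[j])` is obtained from
`d_i^{n,L}x` by replacing its `(j+1)`-st coordinate with
`(d_{i,j}^{n,L}x)(d_{i,j+1}^{n,L}x)(d_{i,j+2}^{n,L}x)T`.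
(Coordinate `d_{i,k}^{n,L}x` of the `(n+1)`-tuple `dL T n i x` is its entry at
index `k - 1`.) -/
theorem dL_of_substituted_tuple {X : Type*} (T L R : X → X → X → X)
    (hq1 : ∀ x1 x2 x3 : X, L (T x1 x2 x3) x2 x3 = x1)
    (hq2 : ∀ x1 x2 x3 : X, T (L x1 x2 x3) x2 x3 = x1)
    (hinv : ∀ x1 x2 x3 : X, T x1 (T x1 x2 x3) x3 = x2)
    (hq5 : ∀ x1 x2 x3 : X, R x1 x2 (T x1 x2 x3) = x3)
    (hq6 : ∀ x1 x2 x3 : X, T x1 x2 (R x1 x2 x3) = x3)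
    (hA3L : ∀ a b c d : X, T (T a b c) c d = T (T a b (T b c d)) (T b c d) d)
    (hA3R : ∀ a b c d : X, T a b (T b c d) = T a (T a b c) (T (T a b c) c d))
    (n : ℕ) (hn : 1 ≤ n) (j : ℕ) (h1 : 1 ≤ j) (h2 : j ≤ n)
    (x : Fin (n + 2) → X) :
    dL T n j (tupleSub T n x j h1 h2) = dL T n (j - 1) x ∧
    ∀ (i : ℕ) (hi1 : j + 1 ≤ i) (hi2 : i ≤ n),
      dL T n i (tupleSub T n x j h1 h2) =
        Function.update (dL T n i x) ⟨j, by omega⟩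
          (T (dL T n i x ⟨j - 1, by omega⟩) (dL T n i x ⟨j, by omega⟩)
            (dL T n i x ⟨j + 1, by omega⟩)) := by
  refine ⟨?_, fun i hi1 hi2 => ?_⟩
  · funext p
    simp only [dL, ext_tupleSub]
    exact dLcoord_seqSub_self T hinv _ h1 (by omega)
  · funext p
    simp only [dL, ext_tupleSub]
    by_cases hp : p = ⟨j, by omega⟩
    · subst hp
      rw [Function.update_self, Nat.sub_add_cancel h1]
      exact dLcoord_seqSub_succ T hA3L _ hi1
    · rw [Function.update_of_ne hp]
      refine dLcoord_seqSub_of_ne T hA3R _ h1 hi1 (by omega) fun h => hp (Fin.ext ?_)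
      simpa using h
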